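/- Let ω be smooth with zero x-average and sufficient decay on 𝕋 × ℝ, ψ = Δ⁻¹ω. Then |⟨yω, y∂ₓΔ⁻¹ω⟩| ≤ 2 ‖yω‖_{L²} ‖ω‖_{L²}. -/

import Mathlib

open MeasureTheory Real

/-- Partial derivative in the first (x) variable. -/
noncomputable def pdx (f : ℝ → ℝ → ℝ) (x y : ℝ) : ℝ := deriv (fun x' => f x' y) x

/-- Partial derivative in the second (y) variable. -/
noncomputable def pdy (f : ℝ → ℝ → ℝ) (x y : ℝ) : ℝ := deriv (fun y' => f x y') y

/-- Laplacian. -/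
noncomputable def lap (f : ℝ → ℝ → ℝ) (x y : ℝ) : ℝ := pdx (pdx f) x y + pdy (pdy f) x y

/-- `f` and all its derivatives decay rapidly in `y`, uniformly in `x`. -/
def RapidDecay (f : ℝ → ℝ → ℝ) : Prop :=
  ∀ k n : ℕ, ∃ C : ℝ, ∀ x y : ℝ,
    |y| ^ n * ‖iteratedFDeriv ℝ k (Function.uncurry f) (x, y)‖ ≤ C

/-- `f` is `2π`-periodic in `x` (i.e. lives on `𝕋 × ℝ`). -/
def PerX (f : ℝ → ℝ → ℝ) : Prop := ∀ y : ℝ, Function.Periodic (fun x => f x y) (2 * π)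

/-- `f` has zero `x`-average. -/
def ZeroAvgX (f : ℝ → ℝ → ℝ) : Prop := ∀ y : ℝ, ∫ x in (0:ℝ)..(2 * π), f x y = 0

open scoped FourierTransform SchwartzMap ComplexConjugate in
lemma mode_pt (k ξ l : ℝ) (hk : 1 ≤ k^2) (hl : 0 < l) (U A B G : ℂ)
    (hG : G = -((k^2 + (2*π*ξ)^2 : ℝ) : ℂ) * U)
    (hB : B = -((k^2 + (2*π*ξ)^2 : ℝ) : ℂ) * A - (4*π*ξ : ℝ) * Complex.I * U) :
    |k * (B * conj A).im| ≤ (l * ‖B‖^2 + l⁻¹ * ‖G‖^2) / 2 := by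
  set p : ℝ := k^2 + (2*π*ξ)^2 with hp
  have hp1 : 1 ≤ p := by nlinarith [sq_nonneg (2*π*ξ)]
  have h1 : p * (B * conj A).im = - (B * conj ((4*π*ξ : ℝ) * Complex.I * U)).im := by
    have : (p:ℂ) * A = -B - (4*π*ξ : ℝ) * Complex.I * U := by rw [hB]; ring
    have h2 : (B * conj ((p:ℂ) * A)).im = p * (B * conj A).im := by
      simp only [map_mul, Complex.conj_ofReal, Complex.mul_im, Complex.mul_re, Complex.ofReal_re,
        Complex.ofReal_im]; ring
    rw [← h2, this, map_sub, mul_sub, Complex.sub_im, map_neg, mul_neg, Complex.neg_im,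
      Complex.mul_conj]
    simp
  have h3 : |p * (B * conj A).im| ≤ ‖B‖ * ((4 * π * |ξ|) * ‖U‖) := by
    rw [h1, abs_neg]
    refine (Complex.abs_im_le_norm _).trans (le_of_eq ?_)
    rw [norm_mul, RCLike.norm_conj, norm_mul, norm_mul, Complex.norm_I, Complex.norm_real]
    simp [abs_of_pos pi_pos]
  have hGn : ‖G‖ = p * ‖U‖ := by
    rw [hG, norm_mul, norm_neg, Complex.norm_real, Real.norm_eq_abs, abs_of_pos (by linarith)]
  have h4 : |k| * (4 * π * |ξ|) ≤ p := by
    have : k^2 = |k|^2 := (sq_abs k).symm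
    have h5 : (2*π*ξ)^2 = (2*π*|ξ|)^2 := by rw [mul_pow, mul_pow _ |ξ|, sq_abs]
    rw [hp, this, h5]; nlinarith [sq_nonneg (|k| - 2*π*|ξ|)]
  have h6 : p * |k * (B * conj A).im| ≤ p * (‖B‖ * ‖G‖) := by
    calc p * |k * (B * conj A).im| = |k| * |p * (B * conj A).im| := by
          rw [abs_mul, abs_mul, abs_of_pos (by linarith : 0 < p)]; ring
      _ ≤ |k| * (‖B‖ * ((4 * π * |ξ|) * ‖U‖)) := by gcongr
      _ = (|k| * (4 * π * |ξ|)) * (‖B‖ * ‖U‖) := by ring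
      _ ≤ p * (‖B‖ * ‖U‖) := by gcongr
      _ ≤ p * (‖B‖ * ‖G‖) := by
          rw [hGn]; gcongr; nlinarith [norm_nonneg U]
  have h7 : |k * (B * conj A).im| ≤ ‖B‖ * ‖G‖ := le_of_mul_le_mul_left h6 (by linarith)
  refine h7.trans ?_
  have h8 : 0 ≤ l⁻¹ * (l * ‖B‖ - ‖G‖)^2 := by positivity
  have h9 : l⁻¹ * (l * ‖B‖ - ‖G‖)^2 = l * ‖B‖^2 + l⁻¹ * ‖G‖^2 - 2 * (‖B‖ * ‖G‖) := by
    field_simp; ring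
  linarith

open scoped FourierTransform SchwartzMap ComplexConjugate in
lemma mode_le (u : 𝓢(ℝ, ℂ)) (k l : ℝ) (hk : 1 ≤ k^2) (hl : 0 < l) (w : ℝ → ℂ)
    (hw : ∀ y, w y = deriv (deriv u) y - (k:ℂ)^2 * u y) :
    |k * ∫ y : ℝ, ((y * w y) * conj (y * u y)).im| ≤
      (l * (∫ y : ℝ, ‖y * w y‖^2) + l⁻¹ * ∫ y : ℝ, ‖w y‖^2) / 2 := by
  have tg : Function.HasTemperateGrowth (fun y : ℝ => y) := by fun_prop
  let W : 𝓢(ℝ, ℂ) := SchwartzMap.derivCLM ℝ ℂ (SchwartzMap.derivCLM ℝ ℂ u) - (k^2) • u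
  have hW : ∀ y, W y = w y := fun y => by
    rw [hw]
    have : ⇑(SchwartzMap.derivCLM ℝ ℂ u) = deriv u := by ext; simp
    simp [W, this]
  let Z : 𝓢(ℝ, ℂ) → 𝓢(ℝ, ℂ) := SchwartzMap.smulLeftCLM ℂ (fun y : ℝ => y)
  have hZ : ∀ f y, Z f y = y * f y := fun f y => by
    simp [Z, SchwartzMap.smulLeftCLM_apply_apply tg]
  have hD : ∀ (f : 𝓢(ℝ, ℂ)) ξ, HasDerivAt (𝓕 f : 𝓢(ℝ,ℂ)) ((-2*π*Complex.I) * (𝓕 (Z f) : 𝓢(ℝ,ℂ)) ξ) ξ := by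
    intro f ξ
    have hi : Integrable (fun x : ℝ ↦ x • f x) := by
      have := (Z f).integrable (μ := volume)
      refine this.congr (Filter.Eventually.of_forall fun y => ?_)
      simp [hZ]
    have h := Real.hasDerivAt_fourier (f.integrable) hi ξ
    rw [SchwartzMap.fourier_coe]
    suffices key : (-2*π*Complex.I) * (𝓕 (Z f) : 𝓢(ℝ,ℂ)) ξ = 𝓕 (fun x : ℝ ↦ (-2 * π * Complex.I * x) • f x) ξ by
      rw [key]; exact h
    have : (fun x : ℝ ↦ (-2 * π * Complex.I * x) • f x) = (-2*π*Complex.I) • ⇑(Z f) := by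
      ext y; simp [hZ]; ring
    rw [this, SchwartzMap.fourier_coe]
    simp only [Real.fourier_real_eq, Pi.smul_apply]
    rw [← smul_eq_mul, ← integral_smul]
    congr 1; ext y
    rw [smul_comm]
  have hDer : ∀ (f : 𝓢(ℝ, ℂ)) (ξ:ℝ), (𝓕 (SchwartzMap.derivCLM ℝ ℂ f) : 𝓢(ℝ,ℂ)) ξ = 2*π*Complex.I*ξ * (𝓕 f : 𝓢(ℝ,ℂ)) ξ := by
    intro f ξ
    have e : ⇑(SchwartzMap.derivCLM ℝ ℂ f) = deriv f := by ext; simp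
    have h := Real.fourier_deriv f.integrable f.differentiable
      (by rw [← e]; exact (SchwartzMap.derivCLM ℝ ℂ f).integrable)
    rw [SchwartzMap.fourier_coe, e, h, SchwartzMap.fourier_coe]
    simp
  have hG : ∀ ξ : ℝ, (𝓕 W : 𝓢(ℝ,ℂ)) ξ = -((k^2 + (2*π*ξ)^2 : ℝ) : ℂ) * (𝓕 u : 𝓢(ℝ,ℂ)) ξ := by
    intro ξ
    have : (𝓕 W : 𝓢(ℝ,ℂ)) = 𝓕 (SchwartzMap.derivCLM ℝ ℂ (SchwartzMap.derivCLM ℝ ℂ u)) - (k^2) • 𝓕 u := by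
      simp only [W, ← SchwartzMap.fourierTransformCLM_apply (𝕜 := ℝ)]
      rw [map_sub, map_smul]
    rw [this, sub_apply, smul_apply, hDer, hDer]
    simp only [Complex.real_smul]
    push_cast
    linear_combination (4*π^2*ξ^2 * (𝓕 u : 𝓢(ℝ,ℂ)) ξ : ℂ) * Complex.I_sq
  have hB : ∀ ξ : ℝ, (𝓕 (Z W) : 𝓢(ℝ,ℂ)) ξ = -((k^2 + (2*π*ξ)^2 : ℝ) : ℂ) * (𝓕 (Z u) : 𝓢(ℝ,ℂ)) ξ
      - (4*π*ξ : ℝ) * Complex.I * (𝓕 u : 𝓢(ℝ,ℂ)) ξ := by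
    intro ξ
    have h1 := hD W ξ
    have e : ⇑(𝓕 W : 𝓢(ℝ,ℂ)) = fun ξ : ℝ => -((k^2 + (2*π*ξ)^2 : ℝ) : ℂ) * (𝓕 u : 𝓢(ℝ,ℂ)) ξ :=
      funext hG
    rw [e] at h1
    have h2 : HasDerivAt (fun ξ : ℝ => k^2 + (2*π*ξ)^2) (8*π^2*ξ) ξ := by
      have := (((hasDerivAt_id ξ).const_mul (2*π)).pow 2).const_add (k^2)
      convert! this using 1
      simp; ring
    have h3 := h2.ofReal_comp.neg.mul (hD u ξ)
    have h4 := h1.unique h3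
    have hpi : (π:ℂ) ≠ 0 := by exact_mod_cast pi_ne_zero
    have h5 : (-2*π*Complex.I) * (𝓕 (Z W) : 𝓢(ℝ,ℂ)) ξ = (-2*π*Complex.I) * (-((k^2 + (2*π*ξ)^2 : ℝ) : ℂ) * (𝓕 (Z u) : 𝓢(ℝ,ℂ)) ξ
      - (4*π*ξ : ℝ) * Complex.I * (𝓕 u : 𝓢(ℝ,ℂ)) ξ) := by
      have h6 : (-fun y : ℝ => ((k^2 + (2*π*y)^2 : ℝ) : ℂ)) ξ = -((k^2 + (2*π*ξ)^2 : ℝ) : ℂ) := rfl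
      rw [h4, h6]; push_cast
      linear_combination (-8*π^2*ξ * (𝓕 u : 𝓢(ℝ,ℂ)) ξ : ℂ) * Complex.I_sq
    exact mul_left_cancel₀ (by simp [hpi]) h5
  -- Plancherel
  have hsq : ∀ f : 𝓢(ℝ,ℂ), Integrable (fun y => ‖f y‖^2) := fun f =>
    (memLp_two_iff_integrable_sq_norm f.continuous.aestronglyMeasurable).1 (f.memLp 2)
  have P1 : ∫ y : ℝ, ((y * w y) * conj (y * u y)).im =
      ∫ ξ : ℝ, ((𝓕 (Z W) : 𝓢(ℝ,ℂ)) ξ * conj ((𝓕 (Z u) : 𝓢(ℝ,ℂ)) ξ)).im := by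
    have hint : ∀ f g : 𝓢(ℝ,ℂ), Integrable (fun y => f y * conj (g y)) := fun f g => by
      have := (f.memLp 2 (μ := volume)).integrable_mul ((g.memLp 2 (μ := volume)).star)
      exact this
    have h := SchwartzMap.integral_inner_fourier_fourier (Z u) (Z W)
    simp only [RCLike.inner_apply] at h
    have e1 := integral_im (hint (Z W) (Z u))
    have e2 := integral_im (hint (𝓕 (Z W)) (𝓕 (Z u)))
    simp only [hZ, hW] at e1 h
    simp only [RCLike.im_to_complex] at e1 e2
    rw [e1, e2, h]
  have P2 : ∫ y : ℝ, ‖y * w y‖^2 = ∫ ξ : ℝ, ‖(𝓕 (Z W) : 𝓢(ℝ,ℂ)) ξ‖^2 := by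
    rw [SchwartzMap.integral_norm_sq_fourier]; simp only [hZ, hW]
  have P3 : ∫ y : ℝ, ‖w y‖^2 = ∫ ξ : ℝ, ‖(𝓕 W : 𝓢(ℝ,ℂ)) ξ‖^2 := by
    rw [SchwartzMap.integral_norm_sq_fourier]; simp only [hW]
  rw [P1, P2, P3, ← integral_const_mul, ← integral_const_mul, ← integral_const_mul,
    ← integral_add ((hsq _).const_mul _) ((hsq _).const_mul _), ← integral_div, ← Real.norm_eq_abs]
  refine norm_integral_le_of_norm_le ((((hsq _).const_mul _).add ((hsq _).const_mul _)).div_const 2)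
    (Filter.Eventually.of_forall fun ξ => ?_)
  exact mode_pt k ξ l hk hl _ _ _ _ (hG ξ) (hB ξ)


/-- Smooth with rapid decay. -/
def NiceFn (f : ℝ → ℝ → ℝ) : Prop :=
  ContDiff ℝ (⊤ : ℕ∞) (Function.uncurry f) ∧ RapidDecay f

lemma pdx_eq {f : ℝ → ℝ → ℝ} (hf : ContDiff ℝ (⊤ : ℕ∞) (Function.uncurry f)) (x y : ℝ) :
    HasDerivAt (fun x' => f x' y) (fderiv ℝ (Function.uncurry f) (x, y) (1, 0)) x := by
  have h := (hf.differentiable (by simp) (x, y)).hasFDerivAt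
  have h2 : HasDerivAt (fun x' : ℝ => (x', y)) ((1:ℝ), (0:ℝ)) x :=
    (hasDerivAt_id x).prodMk (hasDerivAt_const x y)
  exact h.comp_hasDerivAt x h2

lemma pdy_eq {f : ℝ → ℝ → ℝ} (hf : ContDiff ℝ (⊤ : ℕ∞) (Function.uncurry f)) (x y : ℝ) :
    HasDerivAt (fun y' => f x y') (fderiv ℝ (Function.uncurry f) (x, y) (0, 1)) y := by
  have h := (hf.differentiable (by simp) (x, y)).hasFDerivAt
  have h2 : HasDerivAt (fun y' : ℝ => (x, y')) ((0:ℝ), (1:ℝ)) y :=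
    (hasDerivAt_const y x).prodMk (hasDerivAt_id y)
  exact h.comp_hasDerivAt y h2

lemma NiceFn.apply {f g : ℝ → ℝ → ℝ} (hf : NiceFn f) (v : ℝ × ℝ)
    (hg : Function.uncurry g = fun p => fderiv ℝ (Function.uncurry f) p v) : NiceFn g := by
  have h1 : ContDiff ℝ (⊤ : ℕ∞) (fderiv ℝ (Function.uncurry f)) :=
    hf.1.fderiv_right (by simp)
  refine ⟨?_, ?_⟩
  · rw [hg]; exact h1.clm_apply contDiff_const
  · intro k n
    obtain ⟨C, hC⟩ := hf.2 (k+1) n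
    refine ⟨‖v‖ * C, fun x y => ?_⟩
    rw [hg]
    have h2 := norm_iteratedFDeriv_clm_apply_const (c := v) (n := k) (h1.contDiffAt (x := (x,y)))
      (by exact_mod_cast le_top)
    rw [norm_iteratedFDeriv_fderiv] at h2
    calc _ ≤ |y|^n * (‖v‖ * ‖iteratedFDeriv ℝ (k+1) (Function.uncurry f) (x, y)‖) := by gcongr
      _ = ‖v‖ * (|y|^n * ‖iteratedFDeriv ℝ (k+1) (Function.uncurry f) (x, y)‖) := by ring
      _ ≤ _ := by gcongr; exact hC x y

lemma NiceFn.pdx {f : ℝ → ℝ → ℝ} (hf : NiceFn f) : NiceFn (pdx f) :=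
  hf.apply (1, 0) (by ext ⟨x, y⟩; exact (pdx_eq hf.1 x y).deriv)

lemma NiceFn.pdy {f : ℝ → ℝ → ℝ} (hf : NiceFn f) : NiceFn (pdy f) :=
  hf.apply (0, 1) (by ext ⟨x, y⟩; exact (pdy_eq hf.1 x y).deriv)

lemma NiceFn.hasx {f : ℝ → ℝ → ℝ} (hf : NiceFn f) (x y : ℝ) :
    HasDerivAt (fun x' => f x' y) (_root_.pdx f x y) x :=
  (pdx_eq hf.1 x y).differentiableAt.hasDerivAt

lemma NiceFn.hasy {f : ℝ → ℝ → ℝ} (hf : NiceFn f) (x y : ℝ) :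
    HasDerivAt (fun y' => f x y') (_root_.pdy f x y) y :=
  (pdy_eq hf.1 x y).differentiableAt.hasDerivAt

lemma NiceFn.bound {f : ℝ → ℝ → ℝ} (hf : NiceFn f) (n : ℕ) :
    ∃ C : ℝ, ∀ x y, |y|^n * |f x y| ≤ C := by
  obtain ⟨C, hC⟩ := hf.2 0 n
  refine ⟨C, fun x y => ?_⟩
  have := hC x y
  rwa [norm_iteratedFDeriv_zero] at this

lemma NiceFn.cont {f : ℝ → ℝ → ℝ} (hf : NiceFn f) : Continuous (Function.uncurry f) := hf.1.continuous

/-- Fourier coefficient in `x`. -/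
noncomputable def cf (k : ℤ) (f : ℝ → ℝ → ℝ) (y : ℝ) : ℂ :=
  ∫ x in (0:ℝ)..(2 * π), (f x y : ℂ) * Complex.exp (-(Complex.I * k * x))

lemma cf_int {k : ℤ} {f : ℝ → ℝ → ℝ} (hf : Continuous (Function.uncurry f)) (y : ℝ) :
    IntervalIntegrable (fun x => (f x y : ℂ) * Complex.exp (-(Complex.I * k * x))) volume 0 (2*π) := by
  have : Continuous (fun x => f x y) := hf.comp (by fun_prop : Continuous fun x : ℝ => (x, y))
  exact Continuous.intervalIntegrable (by fun_prop) _ _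

lemma cf_cont (k : ℤ) {f : ℝ → ℝ → ℝ} (hf : Continuous (Function.uncurry f)) :
    Continuous (cf k f) := by
  have : Continuous (fun p : ℝ × ℝ => f p.2 p.1) :=
    hf.comp (by fun_prop : Continuous fun p : ℝ × ℝ => (p.2, p.1))
  unfold cf
  apply intervalIntegral.continuous_parametric_intervalIntegral_of_continuous'
  simp only [Function.uncurry_def]
  fun_prop

lemma exp_norm (k : ℤ) (x : ℝ) : ‖Complex.exp (-(Complex.I * k * x))‖ = 1 := by
  rw [Complex.norm_exp]; simp

lemma cf_add (k : ℤ) {f g : ℝ → ℝ → ℝ} (hf : Continuous (Function.uncurry f))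
    (hg : Continuous (Function.uncurry g)) (y : ℝ) :
    cf k (fun x y => f x y + g x y) y = cf k f y + cf k g y := by
  unfold cf
  rw [← intervalIntegral.integral_add (cf_int hf y) (cf_int hg y)]
  congr 1; ext x; push_cast; ring

lemma cf_sub (k : ℤ) {f g : ℝ → ℝ → ℝ} (hf : Continuous (Function.uncurry f))
    (hg : Continuous (Function.uncurry g)) (y : ℝ) :
    cf k (fun x y => f x y - g x y) y = cf k f y - cf k g y := by
  unfold cf
  rw [← intervalIntegral.integral_sub (cf_int hf y) (cf_int hg y)]
  congr 1; ext x; push_cast; ring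

lemma cf_mul (k : ℤ) (f : ℝ → ℝ → ℝ) (y : ℝ) :
    cf k (fun x y => y * f x y) y = y * cf k f y := by
  unfold cf
  rw [← intervalIntegral.integral_const_mul]
  congr 1; ext x; push_cast; ring

lemma cf_norm_le (k : ℤ) {f : ℝ → ℝ → ℝ} {C : ℝ} (y : ℝ) (h : ∀ x, |f x y| ≤ C) :
    ‖cf k f y‖ ≤ C * (2*π) := by
  unfold cf
  refine (intervalIntegral.norm_integral_le_of_norm_le_const (C := C) fun x _ => ?_).trans ?_
  · rw [norm_mul, exp_norm, mul_one, Complex.norm_real]; exact h x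
  · rw [sub_zero, abs_of_pos (by positivity)]

lemma cf_hasDeriv (k : ℤ) {f : ℝ → ℝ → ℝ} (hf : NiceFn f) (y : ℝ) :
    HasDerivAt (cf k f) (cf k (pdy f) y) y := by
  obtain ⟨C, hC⟩ := hf.pdy.bound 0
  refine (intervalIntegral.hasDerivAt_integral_of_dominated_loc_of_deriv_le (s := Set.univ)
    (bound := fun _ => C)
    (F' := fun y x => (pdy f x y : ℂ) * Complex.exp (-(Complex.I * k * x)))
    Filter.univ_mem (Filter.Eventually.of_forall fun z => ?_)
    (cf_int hf.cont y) ?_ ?_ (by simp) ?_).2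
  · exact (intervalIntegrable_iff.1 (cf_int hf.cont z)).aestronglyMeasurable
  · exact (intervalIntegrable_iff.1 (cf_int hf.pdy.cont y)).aestronglyMeasurable
  · refine Filter.Eventually.of_forall fun x _ z _ => ?_
    rw [norm_mul, exp_norm, mul_one, Complex.norm_real]
    simpa using hC x z
  · refine Filter.Eventually.of_forall fun x _ z _ => ?_
    exact (hf.hasy x z).ofReal_comp.mul_const _

lemma NiceFn.iter {f : ℝ → ℝ → ℝ} (hf : NiceFn f) (n : ℕ) : NiceFn (_root_.pdy^[n] f) := by
  induction n with
  | zero => exact hf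
  | succ n ih => rw [Function.iterate_succ_apply']; exact ih.pdy

lemma cf_iter (k : ℤ) {f : ℝ → ℝ → ℝ} (hf : NiceFn f) (n : ℕ) :
    iteratedDeriv n (cf k f) = cf k (pdy^[n] f) := by
  induction n with
  | zero => simp
  | succ n ih =>
    rw [iteratedDeriv_succ, ih, Function.iterate_succ_apply']
    ext y
    exact (cf_hasDeriv k (hf.iter n) y).deriv

open scoped SchwartzMap in
lemma cf_schwartz (k : ℤ) {f : ℝ → ℝ → ℝ} (hf : NiceFn f) :
    ∃ u : 𝓢(ℝ, ℂ), ⇑u = cf k f := by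
  refine ⟨⟨cf k f, ?_, ?_⟩, rfl⟩
  · apply contDiff_of_differentiable_iteratedDeriv (n := ⊤)
    intro m _ 
    rw [cf_iter k hf]
    exact fun y => (cf_hasDeriv k (hf.iter m) y).differentiableAt
  · intro m n
    obtain ⟨C, hC⟩ := (hf.iter n).bound m
    refine ⟨C * (2*π), fun y => ?_⟩
    rw [norm_iteratedFDeriv_eq_norm_iteratedDeriv, cf_iter k hf]
    have := cf_norm_le k (f := fun x y => |y|^m * (pdy^[n] f) x y) (C := C) y
      (fun x => by rw [abs_mul, abs_of_nonneg (by positivity)]; exact hC x y)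
    convert this using 1
    have : cf k (fun x y => |y|^m * (pdy^[n] f) x y) y = ((|y|^m : ℝ):ℂ) * cf k (pdy^[n] f) y := by
      unfold cf
      rw [← intervalIntegral.integral_const_mul]
      congr 1; ext x; push_cast; ring
    rw [this, norm_mul, Complex.norm_real, Real.norm_eq_abs, Real.norm_eq_abs,
      abs_of_nonneg (by positivity : 0 ≤ |y|^m)]

lemma cf_pdx (k : ℤ) {f : ℝ → ℝ → ℝ} (hf : NiceFn f) (hp : PerX f) (y : ℝ) :
    cf k (pdx f) y = Complex.I * k * cf k f y := by
  have hE : ∀ x : ℝ, HasDerivAt (fun x : ℝ => Complex.exp (-(Complex.I * k * x)))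
      (-(Complex.I * k) * Complex.exp (-(Complex.I * k * x))) x := by
    intro x
    have h0 : HasDerivAt (fun x : ℝ => -(Complex.I * k * (x:ℂ))) (-(Complex.I * k)) x := by
      have := ((Complex.ofRealCLM.hasDerivAt (x := x)).const_mul (Complex.I * k)).neg
      convert! this using 1
      simp
    have := h0.cexp
    rwa [mul_comm (Complex.exp _)] at this
  have hcx : Continuous (fun x => pdx f x y) :=
    hf.pdx.cont.comp (by fun_prop : Continuous fun x : ℝ => (x, y))
  have h := intervalIntegral.integral_mul_deriv_eq_deriv_mul (a := 0) (b := 2*π)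
    (u := fun x : ℝ => (f x y : ℂ)) (u' := fun x => (pdx f x y : ℂ))
    (fun x _ => (hf.hasx x y).ofReal_comp) (fun x _ => hE x)
    (Continuous.intervalIntegrable (by fun_prop) _ _)
    (Continuous.intervalIntegrable (by fun_prop) _ _)
  have hper : f (2*π) y = f 0 y := by simpa using hp y 0
  have he : Complex.exp (-(Complex.I * k * ((2*π:ℝ):ℂ))) = 1 := by
    rw [Complex.exp_eq_one_iff]
    exact ⟨-k, by push_cast; ring⟩
  rw [he, hper] at h
  simp only [Complex.ofReal_zero, mul_zero, neg_zero, Complex.exp_zero, sub_self, zero_sub] at h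
  have h2 : ∫ x in (0:ℝ)..(2*π), (f x y : ℂ) * (-(Complex.I * k) * Complex.exp (-(Complex.I * k * x)))
      = -(Complex.I * k) * cf k f y := by
    unfold cf
    rw [← intervalIntegral.integral_const_mul]
    congr 1; ext x; ring
  rw [h2] at h
  unfold cf at h ⊢
  linear_combination h

lemma PerX.pdx {f : ℝ → ℝ → ℝ} (hp : PerX f) : PerX (pdx f) := by
  intro y x
  have : (fun x' => f x' y) = fun x' => f (x' + 2*π) y := by
    ext x'; exact (hp y x').symm
  show deriv (fun x' => f x' y) (x + 2*π) = deriv (fun x' => f x' y) x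
  conv_rhs => rw [this]
  rw [deriv_comp_add_const (f := fun x' => f x' y)]

lemma cf_lap (k : ℤ) {ψ ω : ℝ → ℝ → ℝ} (hψ : NiceFn ψ) (hp : PerX ψ)
    (h : ∀ x y, lap ψ x y = ω x y) (y : ℝ) :
    cf k ω y = deriv (deriv (cf k ψ)) y - ((k:ℝ):ℂ)^2 * cf k ψ y := by
  have e : ω = fun x y => pdx (pdx ψ) x y + pdy (pdy ψ) x y := by
    ext x y; exact (h x y).symm
  have d1 : deriv (cf k ψ) = cf k (pdy ψ) := funext fun y => (cf_hasDeriv k hψ y).deriv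
  rw [e, cf_add k hψ.pdx.pdx.cont hψ.pdy.pdy.cont, cf_pdx k hψ.pdx hp.pdx, cf_pdx k hψ hp, d1,
    (cf_hasDeriv k hψ.pdy y).deriv]
  push_cast
  linear_combination ((k:ℂ)^2 * cf k ψ y) * Complex.I_sq

/-- Decay class for Parseval. -/
def DecFn (f : ℝ → ℝ → ℝ) : Prop :=
  Continuous (Function.uncurry f) ∧ ∃ C : ℝ, ∀ x y, (1 + y^2) * |f x y| ≤ C

lemma pars_pt {f : ℝ → ℝ → ℝ} (hf : Continuous (Function.uncurry f)) (y : ℝ) :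
    HasSum (fun k : ℤ => ‖cf k f y‖^2) (2*π * ∫ x in (0:ℝ)..(2*π), (f x y)^2) := by
  have hc : Continuous (fun x => (f x y : ℂ)) := by
    have : Continuous (fun x => f x y) := hf.comp (by fun_prop : Continuous fun x : ℝ => (x, y))
    fun_prop
  have hab : (0:ℝ) < 2*π := by positivity
  have hm : MemLp (fun x => (f x y : ℂ)) 2 (volume.restrict (Set.Ioc 0 (2*π))) := by
    rw [memLp_two_iff_integrable_sq_norm hc.aestronglyMeasurable]
    exact ((hc.norm.pow 2).integrableOn_Icc (a := 0) (b := 2*π)).mono_set Set.Ioc_subset_Icc_self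
  have h := (hasSum_sq_fourierCoeffOn hab hm).mul_left ((2*π)^2)
  convert! h using 1
  · ext k
    rw [fourierCoeffOn_eq_integral]
    have : ∫ x in (0:ℝ)..(2*π), (fourier (-k)) (x : AddCircle (2*π - 0)) • (f x y : ℂ) = cf k f y := by
      unfold cf
      congr 1; ext x
      rw [fourier_coe_apply, smul_eq_mul, mul_comm]
      congr 2
      push_cast
      have : (π:ℂ) ≠ 0 := by exact_mod_cast pi_ne_zero
      field_simp
      ring
    rw [this, norm_smul]
    simp only [sub_zero, Real.norm_eq_abs, abs_of_pos (by positivity : 0 < 1/(2*π))]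
    field_simp
  · simp only [sub_zero, smul_eq_mul, Complex.norm_real, Real.norm_eq_abs, sq_abs]
    field_simp

lemma int_aux {g : ℝ → ℝ} (hg : Continuous g) {C : ℝ} (h : ∀ y, (1+y^2) * |g y| ≤ C) :
    Integrable g := by
  refine Integrable.mono' (integrable_inv_one_add_sq.const_mul C) hg.aestronglyMeasurable
    (Filter.Eventually.of_forall fun y => ?_)
  have hy : 0 < 1 + y^2 := by positivity
  rw [Real.norm_eq_abs, ← div_eq_mul_inv, le_div_iff₀ hy, mul_comm]
  exact h y

lemma DecFn.int {f : ℝ → ℝ → ℝ} (hf : DecFn f) :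
    Integrable (fun y => ∫ x in (0:ℝ)..(2*π), (f x y)^2) := by
  obtain ⟨hc, C, hC⟩ := hf
  have hc2 : Continuous (fun p : ℝ × ℝ => f p.2 p.1) :=
    hc.comp (by fun_prop : Continuous fun p : ℝ × ℝ => (p.2, p.1))
  refine int_aux (C := C^2 * (2*π)) ?_ fun y => ?_
  · apply intervalIntegral.continuous_parametric_intervalIntegral_of_continuous'
    simp only [Function.uncurry_def]
    fun_prop
  · have hy : 0 < 1 + y^2 := by positivity
    have hb : |∫ x in (0:ℝ)..(2*π), (f x y)^2| ≤ (C^2 / (1+y^2)) * (2*π) := by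
      have := intervalIntegral.norm_integral_le_of_norm_le_const (a := 0) (b := 2*π)
        (f := fun x => (f x y)^2) (C := C^2/(1+y^2)) fun x _ => ?_
      · rwa [sub_zero, abs_of_pos (by positivity), Real.norm_eq_abs] at this
      · rw [Real.norm_eq_abs, abs_pow, le_div_iff₀ hy]
        have h1 := hC x y
        have h0 := abs_nonneg (f x y)
        have h2 : |f x y| ≤ (1+y^2) * |f x y| := by nlinarith [sq_nonneg y]
        nlinarith
    calc _ ≤ (1+y^2) * ((C^2 / (1+y^2)) * (2*π)) := by gcongr
      _ = _ := by field_simp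

lemma pars_sq {f : ℝ → ℝ → ℝ} (hf : DecFn f) :
    HasSum (fun k : ℤ => ∫ y : ℝ, ‖cf k f y‖^2) (2*π * ∫ y : ℝ, ∫ x in (0:ℝ)..(2*π), (f x y)^2) := by
  rw [← integral_const_mul]
  refine hasSum_integral_of_dominated_convergence (fun k y => ‖cf k f y‖^2)
    (fun k => ((cf_cont k hf.1).norm.pow 2).aestronglyMeasurable)
    (fun k => Filter.Eventually.of_forall fun y => by simp)
    (Filter.Eventually.of_forall fun y => (pars_pt hf.1 y).summable) ?_
    (Filter.Eventually.of_forall fun y => pars_pt hf.1 y)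
  simp_rw [fun y => (pars_pt hf.1 y).tsum_eq]
  exact hf.int.const_mul _

lemma DecFn.intcf {f : ℝ → ℝ → ℝ} (hf : DecFn f) (k : ℤ) : Integrable (fun y => ‖cf k f y‖^2) := by
  refine Integrable.mono' (hf.int.const_mul (2*π))
    ((cf_cont k hf.1).norm.pow 2).aestronglyMeasurable (Filter.Eventually.of_forall fun y => ?_)
  rw [Real.norm_eq_abs, abs_of_nonneg (by positivity)]
  exact le_hasSum (pars_pt hf.1 y) k fun _ _ => by positivity

lemma DecFn.add {f g : ℝ → ℝ → ℝ} (hf : DecFn f) (hg : DecFn g) :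
    DecFn (fun x y => f x y + g x y) := by
  obtain ⟨hc, C, hC⟩ := hf
  obtain ⟨hc', C', hC'⟩ := hg
  refine ⟨hc.add hc', C + C', fun x y => ?_⟩
  have := abs_add_le (f x y) (g x y)
  have hy : 0 < 1 + y^2 := by positivity
  nlinarith [hC x y, hC' x y]

lemma DecFn.neg {f : ℝ → ℝ → ℝ} (hf : DecFn f) : DecFn (fun x y => - f x y) := by
  obtain ⟨hc, C, hC⟩ := hf
  exact ⟨hc.neg, C, fun x y => by rw [abs_neg]; exact hC x y⟩

lemma DecFn.sub {f g : ℝ → ℝ → ℝ} (hf : DecFn f) (hg : DecFn g) :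
    DecFn (fun x y => f x y - g x y) := by
  simpa only [sub_eq_add_neg] using hf.add hg.neg

lemma NiceFn.dec {f : ℝ → ℝ → ℝ} (hf : NiceFn f) : DecFn f := by
  obtain ⟨C, hC⟩ := hf.bound 0
  obtain ⟨C', hC'⟩ := hf.bound 2
  refine ⟨hf.cont, C + C', fun x y => ?_⟩
  have h1 := hC x y
  have h2 := hC' x y
  rw [sq_abs] at h2
  linarith

lemma NiceFn.ydec {f : ℝ → ℝ → ℝ} (hf : NiceFn f) : DecFn (fun x y => y * f x y) := by
  obtain ⟨C, hC⟩ := hf.bound 1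
  obtain ⟨C', hC'⟩ := hf.bound 3
  refine ⟨continuous_snd.mul hf.cont, C + C', fun x y => ?_⟩
  have h1 := hC x y
  have h2 := hC' x y
  have : (1+y^2) * |y * f x y| = |y|^1 * |f x y| + |y|^3 * |f x y| := by
    rw [abs_mul, ← sq_abs y]; ring
  linarith

open scoped ComplexConjugate in
lemma pars_mul {f g : ℝ → ℝ → ℝ} (hf : DecFn f) (hg : DecFn g) :
    HasSum (fun k : ℤ => ∫ y : ℝ, (cf k f y * conj (cf k g y)).re)
      (2*π * ∫ y : ℝ, ∫ x in (0:ℝ)..(2*π), f x y * g x y) := by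
  have h := ((pars_sq (hf.add hg)).sub (pars_sq (hf.sub hg))).mul_left (1/4)
  convert! h using 1
  · ext k
    rw [← integral_sub ((hf.add hg).intcf k) ((hf.sub hg).intcf k), ← integral_const_mul]
    congr 1; ext y
    rw [cf_add k hf.1 hg.1, cf_sub k hf.1 hg.1, ← Complex.normSq_eq_norm_sq,
      ← Complex.normSq_eq_norm_sq, Complex.normSq_add, Complex.normSq_sub]
    ring
  · rw [← mul_sub, ← integral_sub (hf.add hg).int (hf.sub hg).int, mul_left_comm,
      ← integral_const_mul (1/4 : ℝ)]
    congr 2; ext y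
    have hc : ∀ {q : ℝ → ℝ → ℝ}, Continuous (Function.uncurry q) → Continuous (fun x => q x y) :=
      fun hq => hq.comp (by fun_prop : Continuous fun x : ℝ => (x, y))
    have c1 := hc hf.1
    have c2 := hc hg.1
    rw [← intervalIntegral.integral_sub (Continuous.intervalIntegrable (by fun_prop) _ _)
      (Continuous.intervalIntegrable (by fun_prop) _ _), ← intervalIntegral.integral_const_mul]
    congr 1; ext x; ring

lemma final_opt {I A B : ℝ} (hA : 0 ≤ A) (hB : 0 ≤ B)
    (h : ∀ l : ℝ, 0 < l → |I| ≤ (l * A + l⁻¹ * B) / 2) : |I| ≤ Real.sqrt A * Real.sqrt B := by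
  set a := Real.sqrt A with ha
  set b := Real.sqrt B with hb
  have ha0 : 0 ≤ a := Real.sqrt_nonneg _
  have hb0 : 0 ≤ b := Real.sqrt_nonneg _
  have hA' : A = a^2 := (Real.sq_sqrt hA).symm
  have hB' : B = b^2 := (Real.sq_sqrt hB).symm
  have key : ∀ e : ℝ, 0 < e → |I| ≤ (a + e) * (b + e) := by
    intro e he
    have hae : 0 < a + e := by linarith
    have hbe : 0 < b + e := by linarith
    refine (h ((b+e)/(a+e)) (by positivity)).trans ?_
    have h1 : (b+e)/(a+e) * A ≤ (b+e)/(a+e) * (a+e)^2 := by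
      rw [hA']; gcongr; linarith
    have h2 : ((b+e)/(a+e))⁻¹ * B ≤ ((b+e)/(a+e))⁻¹ * (b+e)^2 := by
      rw [hB']; gcongr; linarith
    have h3 : (b+e)/(a+e) * (a+e)^2 = (a+e)*(b+e) := by field_simp
    have h4 : ((b+e)/(a+e))⁻¹ * (b+e)^2 = (a+e)*(b+e) := by field_simp
    linarith
  have ht : Filter.Tendsto (fun e : ℝ => (a + e) * (b + e)) (nhdsWithin 0 (Set.Ioi 0))
      (nhds (a * b)) := by
    have : Continuous (fun e : ℝ => (a + e) * (b + e)) := by fun_prop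
    have h0 := this.tendsto 0
    simp only [add_zero] at h0
    exact h0.mono_left nhdsWithin_le_nhds
  exact ge_of_tendsto ht (Filter.eventually_of_mem self_mem_nhdsWithin key)

/-- `|⟨yω, y∂ₓΔ⁻¹ω⟩| ≤ 2 ‖yω‖ ‖ω‖` for `ω` with zero `x`-average, `ψ = Δ⁻¹ω`. -/
theorem stmt8 (ω ψ : ℝ → ℝ → ℝ)
    (hω : ContDiff ℝ (⊤ : ℕ∞) (Function.uncurry ω)) (hωper : PerX ω)
    (hωdec : RapidDecay ω) (hωavg : ZeroAvgX ω)
    (hψ : ContDiff ℝ (⊤ : ℕ∞) (Function.uncurry ψ)) (hψper : PerX ψ)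
    (hψdec : RapidDecay ψ) (hψavg : ZeroAvgX ψ)
    (hΔψ : ∀ x y, lap ψ x y = ω x y) :
    |∫ y : ℝ, ∫ x in (0:ℝ)..(2 * π), (y * ω x y) * (y * pdx ψ x y)| ≤
      2 * Real.sqrt (∫ y : ℝ, ∫ x in (0:ℝ)..(2 * π), (y * ω x y) ^ 2)
        * Real.sqrt (∫ y : ℝ, ∫ x in (0:ℝ)..(2 * π), (ω x y) ^ 2) := by
  have nψ : NiceFn ψ := ⟨hψ, hψdec⟩
  have nω : NiceFn ω := ⟨hω, hωdec⟩
  set A := ∫ y : ℝ, ∫ x in (0:ℝ)..(2 * π), (y * ω x y) ^ 2 with hA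
  set B := ∫ y : ℝ, ∫ x in (0:ℝ)..(2 * π), (ω x y) ^ 2 with hB
  set I := ∫ y : ℝ, ∫ x in (0:ℝ)..(2 * π), (y * ω x y) * (y * pdx ψ x y) with hI
  have hpi : 0 ≤ 2 * π := by positivity
  have A0 : 0 ≤ A := integral_nonneg fun y =>
    intervalIntegral.integral_nonneg hpi fun x _ => sq_nonneg _
  have B0 : 0 ≤ B := integral_nonneg fun y =>
    intervalIntegral.integral_nonneg hpi fun x _ => sq_nonneg _
  have sA := pars_sq nω.ydec
  have sB := pars_sq nω.dec
  have sI := pars_mul nω.ydec nψ.pdx.ydec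
  have main : |I| ≤ Real.sqrt A * Real.sqrt B := by
    refine final_opt A0 B0 fun l hl => ?_
    have hk : ∀ k : ℤ, |∫ y : ℝ, (cf k (fun x y => y * ω x y) y *
          (starRingEnd ℂ) (cf k (fun x y => y * pdx ψ x y) y)).re| ≤
        (l * (∫ y : ℝ, ‖cf k (fun x y => y * ω x y) y‖^2) + l⁻¹ * ∫ y : ℝ, ‖cf k ω y‖^2) / 2 := by
      intro k
      obtain ⟨u, hu⟩ := cf_schwartz k nψ
      have e : ∫ y : ℝ, (cf k (fun x y => y * ω x y) y *
          (starRingEnd ℂ) (cf k (fun x y => y * pdx ψ x y) y)).re =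
          (k:ℝ) * ∫ y : ℝ, ((y * cf k ω y) * (starRingEnd ℂ) (y * u y)).im := by
        rw [← integral_const_mul]
        congr 1; ext y
        rw [cf_mul, cf_mul, cf_pdx k nψ hψper, hu]
        have : (y * cf k ω y) * (starRingEnd ℂ) (y * (Complex.I * k * cf k ψ y)) =
            ((k:ℝ):ℂ) * (-Complex.I * ((y * cf k ω y) * (starRingEnd ℂ) (y * cf k ψ y))) := by
          simp only [map_mul, Complex.conj_I, Complex.conj_ofReal, map_intCast]
          push_cast; ring
        rw [this, Complex.re_ofReal_mul]
        simp
      rw [e]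
      rcases eq_or_ne k 0 with rfl | hk0
      · simp only [Int.cast_zero, zero_mul, abs_zero]
        have h1 : 0 ≤ ∫ y : ℝ, ‖cf 0 (fun x y => y * ω x y) y‖^2 :=
          integral_nonneg fun y => by positivity
        have h2 : 0 ≤ ∫ y : ℝ, ‖cf 0 ω y‖^2 := integral_nonneg fun y => by positivity
        positivity
      · have h1 : (1:ℝ) ≤ (k:ℝ)^2 := by
          have : 1 ≤ k^2 := by
            have := sq_pos_of_ne_zero hk0
            omega
          exact_mod_cast this
        have := mode_le u k l h1 hl (cf k ω) (fun y => by
          rw [hu]; exact cf_lap k nψ hψper hΔψ y)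
        simpa only [cf_mul] using this
    have sR := ((sA.mul_left l).add (sB.mul_left l⁻¹)).div_const 2
    have u1 := hasSum_le (fun k => (abs_le.1 (hk k)).2) sI sR
    have u2 := hasSum_le (fun k => (abs_le.1 (hk k)).1) sR.neg sI
    have hp : 0 < 2 * π := by positivity
    rw [← hI] at u1 u2
    rw [← hA, ← hB] at u1 u2
    rw [abs_le]
    constructor
    · refine le_of_mul_le_mul_left ?_ hp
      linarith
    · refine le_of_mul_le_mul_left ?_ hp
      linarith
  have := mul_nonneg (Real.sqrt_nonneg A) (Real.sqrt_nonneg B)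
  linarith
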